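/- arXiv:2411.10623 — 6 statements merged into one kernel-verified Lean document; each statement's English description precedes it below -/
import Mathlib

section
/- Let I be a positive integer and let R_1, …, R_I be positive reals. For each i set Γ_i = max{R_i, 1/R_i} and γ_i = log Γ_i (so γ_i ≥ 0). Then there exist reals u_{i1}, u_{i2} ∈ [0,1] for i = 1,…,I such that for every array (a_{ij}) with a_{ij} ∈ {0,1} and a_{i1} + a_{i2} = 1 for all i, one has ∏_{i=1}^I (1/(1+R_i))^{a_{i1}} (R_i/(1+R_i))^{a_{i2}} = ∏_{i=1}^I exp(γ_i (a_{i1} u_{i1} + a_{i2} u_{i2})) / (exp(γ_i u_{i1}) + exp(γ_i u_{i2})). In particular, the product measure on within-pair assignments in which, independently across pairs, the first coordinate is selected with probability 1/(1+R_i) and the second with probability R_i/(1+R_i) coincides exactly with Rosenbaum's biased-randomization distribution with sensitivity parameters γ_i = log max{R_i, 1/R_i}. -/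
/-- For positive `r`, the logarithm of the folded odds `max r r⁻¹` is nonnegative. -/
theorem log_max_inv_nonneg {r : ℝ} (hr : 0 < r) : 0 ≤ Real.log (max r r⁻¹) := by
  apply Real.log_nonneg
  rcases le_total 1 r with h | h
  · exact le_max_of_le_left h
  · exact le_max_of_le_right ((one_le_inv₀ hr).2 h)

/-- Odds `r` are an exponential tilt with parameter `log (max r r⁻¹)` between two points of the
unit interval. -/
theorem exists_unit_exp_tilt {r : ℝ} (hr : 0 < r) :
    ∃ v : Fin 2 → ℝ, (∀ j, v j ∈ Set.Icc (0 : ℝ) 1) ∧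
      Real.exp (Real.log (max r r⁻¹) * v 1) = r * Real.exp (Real.log (max r r⁻¹) * v 0) := by
  rcases le_total 1 r with h | h
  · refine ⟨![0, 1], fun j => by fin_cases j <;> simp, ?_⟩
    rw [max_eq_left ((inv_le_one_of_one_le₀ h).trans h)]
    simp [Real.exp_log hr]
  · refine ⟨![1, 0], fun j => by fin_cases j <;> simp, ?_⟩
    rw [max_eq_right (h.trans ((one_le_inv₀ hr).2 h))]
    simp [Real.exp_neg, Real.exp_log hr, hr.ne']

/-- Theorem 2 (matched pair studies): the within-pair product distribution with
odds `R i` coincides with Rosenbaum's biased-randomization distribution with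
sensitivity parameters `γ i = log (max (R i) (R i)⁻¹)` for some `u i j ∈ [0,1]`. -/
theorem stmt_0 (I : ℕ) (hI : 0 < I) (R : Fin I → ℝ) (hR : ∀ i, 0 < R i)
    (Γ : Fin I → ℝ) (hΓ : ∀ i, Γ i = max (R i) (R i)⁻¹)
    (γ : Fin I → ℝ) (hγ : ∀ i, γ i = Real.log (Γ i)) :
    (∀ i, 0 ≤ γ i) ∧
    ∃ u : Fin I → Fin 2 → ℝ, (∀ i j, u i j ∈ Set.Icc (0 : ℝ) 1) ∧
      ∀ a : Fin I → Fin 2 → ℝ,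
        (∀ i j, a i j = 0 ∨ a i j = 1) → (∀ i, a i 0 + a i 1 = 1) →
        ∏ i, (1 / (1 + R i)) ^ (a i 0) * (R i / (1 + R i)) ^ (a i 1)
          = ∏ i, Real.exp (γ i * (a i 0 * u i 0 + a i 1 * u i 1)) /
              (Real.exp (γ i * u i 0) + Real.exp (γ i * u i 1)) := by
  refine ⟨fun i => ?_, ?_⟩
  · rw [hγ, hΓ]
    exact log_max_inv_nonneg (hR i)
  · choose u hu hexp using fun i => exists_unit_exp_tilt (hR i)
    refine ⟨u, hu, fun a ha hsum => Finset.prod_congr rfl fun i _ => ?_⟩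
    have htilt := hexp i
    rw [← hΓ, ← hγ] at htilt
    have hpos := Real.exp_pos (γ i * u i 0)
    have hRi := hR i
    rcases ha i 0 with h0 | h0
    · have h1 : a i 1 = 1 := by linarith [hsum i]
      simp only [h0, h1, Real.rpow_zero, Real.rpow_one, zero_mul, one_mul, zero_add]
      rw [htilt]
      field_simp
    · have h1 : a i 1 = 0 := by linarith [hsum i]
      simp only [h0, h1, Real.rpow_zero, Real.rpow_one, zero_mul, one_mul, mul_one, add_zero]
      rw [htilt]
      field_simp
end

section
/- Let I be a positive integer and let R̂_1, …, R̂_I and R̃_1, …, R̃_I be positive reals. For each i set R_i = R̂_i R̃_i, Γ̃_i = max{R̃_i, 1/R̃_i}, and γ̃_i = log Γ̃_i (so γ̃_i ≥ 0). Then there exist reals u_{i1}, u_{i2} ∈ [0,1] for i = 1,…,I such that for every array (a_{ij}) with a_{ij} ∈ {0,1} and a_{i1} + a_{i2} = 1 for all i, one has ∏_{i=1}^I (1/(1+R_i))^{a_{i1}} (R_i/(1+R_i))^{a_{i2}} = ∏_{i=1}^I exp(a_{i1} γ̃_i u_{i1} + a_{i2}(log R̂_i + γ̃_i u_{i2}))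 / (exp(γ̃_i u_{i1}) + exp(log R̂_i + γ̃_i u_{i2})). -/
theorem log_max_inv_eq_abs_log {r : ℝ} (hr : 0 < r) :
    Real.log (max r r⁻¹) = |Real.log r| := by
  rcases le_total 1 r with h | h
  · rw [max_eq_left ((inv_le_one_of_one_le₀ h).trans h), abs_of_nonneg (Real.log_nonneg h)]
  · rw [max_eq_right (h.trans ((one_le_inv₀ hr).2 h)), Real.log_inv,
      abs_of_nonpos (Real.log_nonpos hr.le h)]

/-- Every real is `|x|` times a difference of two points of the unit interval. -/
theorem exists_abs_mul_eq_add (x : ℝ) :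
    ∃ u : Fin 2 → ℝ, (∀ j, u j ∈ Set.Icc (0 : ℝ) 1) ∧ |x| * u 1 = x + |x| * u 0 := by
  rcases le_total 0 x with h | h
  · exact ⟨![0, 1], by simp [Fin.forall_fin_two], by simp [abs_of_nonneg h]⟩
  · exact ⟨![1, 0], by simp [Fin.forall_fin_two], by simp [abs_of_nonpos h]⟩

/-- A two-point distribution with odds `p * r` in logistic form with offset `log p`. -/
theorem two_point_eq_logistic {p r s t a b : ℝ} (hp : 0 < p) (hr : 0 < r)
    (ht : t = Real.log r + s) (ha : a = 0 ∨ a = 1) (hab : a + b = 1) :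
    (1 / (1 + p * r)) ^ a * (p * r / (1 + p * r)) ^ b =
      Real.exp (a * s + b * (Real.log p + t)) / (Real.exp s + Real.exp (Real.log p + t)) := by
  have hexp : Real.exp (Real.log p + t) = p * r * Real.exp s := by
    rw [ht, Real.exp_add, Real.exp_add, Real.exp_log hp, Real.exp_log hr, mul_assoc]
  have hs : Real.exp s ≠ 0 := (Real.exp_pos s).ne'
  have hden : 1 + p * r ≠ 0 := by positivity
  have hsum : Real.exp s + p * r * Real.exp s = (1 + p * r) * Real.exp s := by ring
  rcases ha with rfl | rfl
  · obtain rfl : b = 1 := by linarith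
    simp only [Real.rpow_zero, Real.rpow_one, zero_mul, zero_add, one_mul, hexp, hsum]
    field_simp
  · obtain rfl : b = 0 := by linarith
    simp only [Real.rpow_zero, Real.rpow_one, zero_mul, add_zero, one_mul, mul_one, hexp, hsum]
    field_simp

/-- Theorem 3 (adaptive permutation inference for matched pairs): when the
within-pair odds factor as `R i = R̂ i * R̃ i`, the within-pair product
distribution equals a covariate-adaptive biased-randomization distribution
with baseline offsets `log (R̂ i)` and sensitivity parameters
`γ̃ i = log (max (R̃ i) (R̃ i)⁻¹)`. -/
theorem stmt_1 (I : ℕ) (hI : 0 < I) (Rhat Rtil : Fin I → ℝ)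
    (hRhat : ∀ i, 0 < Rhat i) (hRtil : ∀ i, 0 < Rtil i)
    (R : Fin I → ℝ) (hR : ∀ i, R i = Rhat i * Rtil i)
    (Γtil : Fin I → ℝ) (hΓtil : ∀ i, Γtil i = max (Rtil i) (Rtil i)⁻¹)
    (γtil : Fin I → ℝ) (hγtil : ∀ i, γtil i = Real.log (Γtil i)) :
    (∀ i, 0 ≤ γtil i) ∧
    ∃ u : Fin I → Fin 2 → ℝ, (∀ i j, u i j ∈ Set.Icc (0 : ℝ) 1) ∧
      ∀ a : Fin I → Fin 2 → ℝ,
        (∀ i j, a i j = 0 ∨ a i j = 1) → (∀ i, a i 0 + a i 1 = 1) →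
        ∏ i, (1 / (1 + R i)) ^ (a i 0) * (R i / (1 + R i)) ^ (a i 1)
          = ∏ i, Real.exp (a i 0 * (γtil i * u i 0)
                  + a i 1 * (Real.log (Rhat i) + γtil i * u i 1)) /
              (Real.exp (γtil i * u i 0)
                  + Real.exp (Real.log (Rhat i) + γtil i * u i 1)) := by
  have hγ : ∀ i, γtil i = |Real.log (Rtil i)| := fun i => by
    rw [hγtil, hΓtil, log_max_inv_eq_abs_log (hRtil i)]
  choose u hu hdiff using fun i => exists_abs_mul_eq_add (Real.log (Rtil i))
  refine ⟨fun i => hγ i ▸ abs_nonneg _, u, hu, fun a ha hsum => ?_⟩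
  refine Finset.prod_congr rfl fun i _ => ?_
  rw [hR, hγ]
  exact two_point_eq_logistic (hRhat i) (hRtil i) (hdiff i) (ha i 0) (hsum i)
end

section
/- Let n ≥ 1 and let p_1, …, p_n be positive reals with ∑_{j=1}^n p_j = 1. Let Γ ≥ 1 be such that p_j / p_k ≤ Γ for all j, k ∈ {1,…,n}, and set γ = log Γ. Then there exist u_1, …, u_n ∈ [0,1] such that p_j = exp(γ u_j) / ∑_{k=1}^n exp(γ u_k) for every j ∈ {1,…,n}. -/
/-- Theorem 5 (matched set studies): any probability vector with pairwise
probability ratios bounded by `Γ` can be written exactly in Rosenbaum's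
exponential-tilt form with confounders `u j ∈ [0,1]` and `γ = log Γ`. -/
theorem stmt_2 (n : ℕ) (hn : 1 ≤ n) (p : Fin n → ℝ) (hp : ∀ j, 0 < p j)
    (hsum : ∑ j, p j = 1) (Γ : ℝ) (hΓ : 1 ≤ Γ)
    (hratio : ∀ j k, p j / p k ≤ Γ)
    (γ : ℝ) (hγ : γ = Real.log Γ) :
    ∃ u : Fin n → ℝ, (∀ j, u j ∈ Set.Icc (0 : ℝ) 1) ∧
      ∀ j, p j = Real.exp (γ * u j) / ∑ k, Real.exp (γ * u k) := by
  have : Nonempty (Fin n) := ⟨⟨0, hn⟩⟩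
  obtain ⟨m, hm⟩ := Finite.exists_min p
  have hlog_nonneg : ∀ j, 0 ≤ Real.log (p j / p m) := fun j =>
    Real.log_nonneg ((one_le_div (hp m)).2 (hm j))
  have hlog_le : ∀ j, Real.log (p j / p m) ≤ γ := fun j =>
    hγ ▸ Real.log_le_log (div_pos (hp j) (hp m)) (hratio j m)
  have hγ_nonneg : 0 ≤ γ := hγ ▸ Real.log_nonneg hΓ
  have hexp : ∀ j, Real.exp (γ * (Real.log (p j / p m) / γ)) = p j / p m := fun j => by
    rw [mul_div_cancel_of_imp' fun h => le_antisymm (h ▸ hlog_le j) (hlog_nonneg j),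
      Real.exp_log (div_pos (hp j) (hp m))]
  refine ⟨fun j => Real.log (p j / p m) / γ,
    fun j => ⟨div_nonneg (hlog_nonneg j) hγ_nonneg, div_le_one_of_le₀ (hlog_le j) hγ_nonneg⟩,
    fun j => ?_⟩
  simp only [hexp]
  rw [← Finset.sum_div, hsum, div_div_div_cancel_right₀ (hp m).ne', div_one]
end

section
/- Let n ≥ 1, let p_1, …, p_n be positive reals with ∑_{j=1}^n p_j = 1, and let p̂_1, …, p̂_n be positive reals. Let Γ̃ ≥ 1 be such that (p_j/p̂_j)/(p_k/p̂_k) ≤ Γ̃ for all j, k ∈ {1,…,n}, and set γ̃ = log Γ̃. Then there exist u_1, …, u_n ∈ [0,1] such that p_j = exp(log p̂_j + γ̃ u_j) / ∑_{k=1}^n exp(log p̂_k + γ̃ u_k) for every j ∈ {1,…,n}. -/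
/-- Theorem 6 (adaptive permutation inference for matched sets): any
probability vector `p` whose ratios relative to positive baseline weights `p̂`
are bounded by `Γ̃` can be written exactly in the covariate-adaptive
exponential-tilt form with `u j ∈ [0,1]` and `γ̃ = log Γ̃`. -/
theorem stmt_3 (n : ℕ) (hn : 1 ≤ n) (p : Fin n → ℝ) (hp : ∀ j, 0 < p j)
    (hsum : ∑ j, p j = 1) (phat : Fin n → ℝ) (hphat : ∀ j, 0 < phat j)
    (Γtil : ℝ) (hΓtil : 1 ≤ Γtil)
    (hratio : ∀ j k, (p j / phat j) / (p k / phat k) ≤ Γtil)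
    (γtil : ℝ) (hγtil : γtil = Real.log Γtil) :
    ∃ u : Fin n → ℝ, (∀ j, u j ∈ Set.Icc (0 : ℝ) 1) ∧
      ∀ j, p j = Real.exp (Real.log (phat j) + γtil * u j) /
        ∑ k, Real.exp (Real.log (phat k) + γtil * u k) := by
  subst hγtil
  have : Nonempty (Fin n) := ⟨⟨0, hn⟩⟩
  obtain ⟨m, hm⟩ := Finite.exists_min fun j => p j / phat j
  have hr : ∀ j, 0 < p j / phat j := fun j => div_pos (hp j) (hphat j)
  have hγ : 0 ≤ Real.log Γtil := Real.log_nonneg hΓtil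
  have hlog_nonneg : ∀ j, 0 ≤ Real.log ((p j / phat j) / (p m / phat m)) := fun j =>
    Real.log_nonneg ((one_le_div (hr m)).2 (hm j))
  have hlog_le : ∀ j, Real.log ((p j / phat j) / (p m / phat m)) ≤ Real.log Γtil := fun j =>
    Real.log_le_log (div_pos (hr j) (hr m)) (hratio j m)
  -- When `Γtil = 1`, the logarithms all vanish and so does `u`.
  let u : Fin n → ℝ := fun j => Real.log ((p j / phat j) / (p m / phat m)) / Real.log Γtil
  have hexp : ∀ j, Real.exp (Real.log (phat j) + Real.log Γtil * u j) =
      p j / (p m / phat m) := by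
    intro j
    have hmul : Real.log Γtil * u j = Real.log ((p j / phat j) / (p m / phat m)) :=
      mul_div_cancel_of_imp' fun h0 => le_antisymm ((hlog_le j).trans_eq h0) (hlog_nonneg j)
    rw [hmul, Real.exp_add, Real.exp_log (hphat j), Real.exp_log (div_pos (hr j) (hr m)),
      ← mul_div_assoc, mul_div_cancel₀ _ (hphat j).ne']
  refine ⟨u, fun j => ⟨div_nonneg (hlog_nonneg j) hγ, div_le_one_of_le₀ (hlog_le j) hγ⟩,
    fun j => ?_⟩
  simp_rw [hexp]
  rw [← Finset.sum_div, hsum, div_div_div_cancel_right₀ (hr m).ne', div_one]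
end

section
/- For j ≠ k in {1,…,n} and l ∈ {2,…,n}, define R_{jkl} = [ c(j,1)/c(j,l) · b_l(k)/b_l(j) ] / [ c(k,1)/c(k,l) · a(k)/a(j) ], and set Γ̄ = max over all j ≠ k and l ∈ {2,…,n} of R_{jkl}. Then Γ̄ ≥ 1, and for all j ≠ k in {1,…,n}: Γ̄^{-1} ≤ ( ∑_{σ ∈ S_n : σ(1) = j} p_σ π_σ ) / ( ∑_{σ ∈ S_n : σ(1) = k} p_σ π_σ ) ≤ Γ̄. -/
/-- The product `p_σ = ∏ m, c (σ m) m`. -/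
noncomputable def pPerm {n : ℕ} (c : Fin n → Fin n → ℝ) (σ : Equiv.Perm (Fin n)) : ℝ :=
  ∏ m, c (σ m) m

/-- The product `π_σ = a (σ 0) * ∏_{m ≠ 0} b m (σ m)`, where index `0 : Fin n`
plays the role of the first (treated) position. -/
noncomputable def piPerm {n : ℕ} [NeZero n] (a : Fin n → ℝ) (b : Fin n → Fin n → ℝ)
    (σ : Equiv.Perm (Fin n)) : ℝ :=
  a (σ 0) * ∏ m ∈ Finset.univ.erase 0, b m (σ m)

open Equiv Finset

/-- Composing a permutation with a transposition only changes the two factors of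
`∏ m, f m (σ m)` at the transposed indices. -/
lemma prod_perm_mul_swap {ι M : Type*} [Fintype ι] [DecidableEq ι] [CommMonoid M]
    (f : ι → ι → M) (σ : Perm ι) {i l : ι} (hil : i ≠ l) :
    (∏ m, f m (σ m)) * (f i (σ l) * f l (σ i)) =
      (∏ m, f m ((σ * swap i l) m)) * (f i (σ i) * f l (σ l)) := by
  have hl : l ∈ univ.erase i := by simp [hil.symm]
  have hrest : ∏ m ∈ (univ.erase i).erase l, f m ((σ * swap i l) m) =
      ∏ m ∈ (univ.erase i).erase l, f m (σ m) := by
    refine prod_congr rfl fun m hm => ?_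
    simp only [mem_erase, mem_univ, and_true] at hm
    rw [Perm.mul_apply, swap_apply_of_ne_of_ne hm.2 hm.1]
  rw [← mul_prod_erase univ _ (mem_univ i), ← mul_prod_erase _ _ hl,
    ← mul_prod_erase univ (fun m => f m ((σ * swap i l) m)) (mem_univ i),
    ← mul_prod_erase _ (fun m => f m ((σ * swap i l) m)) hl, hrest]
  simp only [Perm.mul_apply, swap_apply_left, swap_apply_right]
  ac_rfl

/-- `p_σ π_σ` as a single product over all positions. -/
lemma pPerm_mul_piPerm {n : ℕ} [NeZero n] (c : Fin n → Fin n → ℝ) (a : Fin n → ℝ)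
    (b : Fin n → Fin n → ℝ) (σ : Perm (Fin n)) :
    pPerm c σ * piPerm a b σ = ∏ m, c (σ m) m * (if m = 0 then a (σ m) else b m (σ m)) := by
  rw [prod_mul_distrib, pPerm, piPerm, ← mul_prod_erase univ
    (fun m => if m = 0 then a (σ m) else b m (σ m)) (mem_univ 0), if_pos rfl]
  congr 2
  exact prod_congr rfl fun m hm => (if_neg (ne_of_mem_erase hm)).symm

/-- A bound on how much swapping the values `j` and `k` changes a weight on permutations
bounds the total weight of `{σ | σ i = j}` by that of `{σ | σ i = k}`. -/
lemma sum_perm_filter_le_of_swap {ι : Type*} [Fintype ι] [DecidableEq ι] (w : Perm ι → ℝ)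
    (i j k : ι) (C : ℝ) (h : ∀ σ : Perm ι, σ i = j → w σ ≤ C * w (swap j k * σ)) :
    ∑ σ ∈ univ.filter (fun σ : Perm ι => σ i = j), w σ ≤
      C * ∑ σ ∈ univ.filter (fun σ : Perm ι => σ i = k), w σ := by
  have hsum : ∑ σ ∈ univ.filter (fun σ : Perm ι => σ i = k), w σ =
      ∑ σ ∈ univ.filter (fun σ : Perm ι => σ i = j), w (swap j k * σ) := by
    symm
    refine sum_equiv (Equiv.mulLeft (swap j k)) (fun σ => ?_) (fun σ _ => rfl)
    simp [swap_apply_eq_iff]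
  rw [hsum, mul_sum]
  exact sum_le_sum fun σ hσ => h σ (mem_filter.1 hσ).2

/-- The tighter bound `Γ̄` of the supplementary material: with
`R j k l = [c(j,0)/c(j,l) · b_l(k)/b_l(j)] / [c(k,0)/c(k,l) · a(k)/a(j)]` and
`Γ̄` the maximum of `R j k l` over `j ≠ k` and `l ≠ 0`, one has `Γ̄ ≥ 1` and the
ratio of sums of `p_σ π_σ` over `{σ(0) = j}` versus `{σ(0) = k}` lies in
`[Γ̄⁻¹, Γ̄]`. -/
theorem stmt_8 (n : ℕ) [NeZero n] (hn : 2 ≤ n)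
    (c : Fin n → Fin n → ℝ) (hc : ∀ j m, 0 < c j m)
    (a : Fin n → ℝ) (ha : ∀ j, 0 < a j)
    (b : Fin n → Fin n → ℝ) (hb : ∀ m j, m ≠ 0 → 0 < b m j)
    (R : Fin n → Fin n → Fin n → ℝ)
    (hR : ∀ j k l, R j k l
      = (c j 0 / c j l * (b l k / b l j)) / (c k 0 / c k l * (a k / a j)))
    (Γbar : ℝ)
    (hΓbar : IsGreatest {x : ℝ | ∃ j k l, j ≠ k ∧ l ≠ 0 ∧ x = R j k l} Γbar) :
    1 ≤ Γbar ∧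
    ∀ j k : Fin n, j ≠ k →
      Γbar⁻¹ ≤ (∑ σ ∈ Finset.univ.filter (fun σ : Equiv.Perm (Fin n) => σ 0 = j),
                  pPerm c σ * piPerm a b σ)
              / (∑ σ ∈ Finset.univ.filter (fun σ : Equiv.Perm (Fin n) => σ 0 = k),
                  pPerm c σ * piPerm a b σ) ∧
      (∑ σ ∈ Finset.univ.filter (fun σ : Equiv.Perm (Fin n) => σ 0 = j),
          pPerm c σ * piPerm a b σ)
        / (∑ σ ∈ Finset.univ.filter (fun σ : Equiv.Perm (Fin n) => σ 0 = k),
            pPerm c σ * piPerm a b σ) ≤ Γbar := by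
  have hmem : ∀ j k l, j ≠ k → l ≠ 0 → R j k l ≤ Γbar := fun j k l hjk hl =>
    hΓbar.2 ⟨j, k, l, hjk, hl, rfl⟩
  have hRpos : ∀ j k l, l ≠ 0 → 0 < R j k l := fun j k l hl => by
    have := hc j 0; have := hc j l; have := hc k 0; have := hc k l
    have := ha j; have := ha k; have := hb l j hl; have := hb l k hl
    rw [hR]; positivity
  have hRinv : ∀ j k l, l ≠ 0 → R j k l * R k j l = 1 := fun j k l hl => by
    have := hc j 0; have := hc j l; have := hc k 0; have := hc k l
    have := ha j; have := ha k; have := hb l j hl; have := hb l k hl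
    rw [hR, hR]; field_simp
  have hone : 1 ≤ Γbar := by
    obtain ⟨j, k, l, hjk, hl, h⟩ := hΓbar.1
    have h₁ := hmem k j l hjk.symm hl
    have h₂ := hRinv j k l hl
    have h₃ := hRpos j k l hl
    rw [← h] at h₂ h₃
    nlinarith
  have hwpos : ∀ σ : Perm (Fin n), 0 < pPerm c σ * piPerm a b σ := fun σ =>
    mul_pos (prod_pos fun m _ => hc _ _)
      (mul_pos (ha _) (prod_pos fun m hm => hb _ _ (ne_of_mem_erase hm)))
  have hsumpos : ∀ j, 0 < ∑ σ ∈ univ.filter (fun σ : Perm (Fin n) => σ 0 = j),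
      pPerm c σ * piPerm a b σ := fun j =>
    sum_pos (fun σ _ => hwpos σ) ⟨swap 0 j, by simp⟩
  have hle : ∀ j k, j ≠ k →
      ∑ σ ∈ univ.filter (fun σ : Perm (Fin n) => σ 0 = j), pPerm c σ * piPerm a b σ ≤
        Γbar * ∑ σ ∈ univ.filter (fun σ : Perm (Fin n) => σ 0 = k),
          pPerm c σ * piPerm a b σ := by
    intro j k hjk
    refine sum_perm_filter_le_of_swap _ 0 j k Γbar fun σ hj => ?_
    obtain ⟨l, hk⟩ := σ.surjective k
    have hl : l ≠ 0 := by
      rintro rfl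
      exact hjk (hj.symm.trans hk)
    have hswap : swap j k * σ = σ * swap 0 l := by rw [mul_swap_eq_swap_mul, hj, hk]
    have key := prod_perm_mul_swap
      (fun m x => c x m * (if m = 0 then a x else b m x)) σ hl.symm
    simp only [← pPerm_mul_piPerm, hj, hk, if_pos, if_neg hl] at key
    have hratio : pPerm c σ * piPerm a b σ =
        R j k l * (pPerm c (σ * swap 0 l) * piPerm a b (σ * swap 0 l)) := by
      have := hc j 0; have := hc j l; have := hc k 0; have := hc k l
      have := ha j; have := ha k; have := hb l j hl; have := hb l k hl
      rw [hR]
      field_simp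
      linear_combination key
    rw [hswap, hratio]
    exact mul_le_mul_of_nonneg_right (hmem j k l hjk hl) (hwpos _).le
  refine ⟨hone, fun j k hjk => ⟨?_, (div_le_iff₀ (hsumpos k)).2 (hle j k hjk)⟩⟩
  rw [le_div_iff₀ (hsumpos k), inv_mul_le_iff₀ (zero_lt_one.trans_le hone)]
  exact hle k j hjk.symm
end

section
/- Define p_{mj} = ∑_{σ ∈ S_n : σ(1) = j} p_σ for j ∈ {1,…,n}. Then max_{j,k ∈ {1,…,n}} p_{mj} / p_{mk} ≤ max_{j,k,l ∈ {1,…,n}} [ c(j,1)/c(j,l) ] / [ c(k,1)/c(k,l) ]. -/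
theorem pPerm_pos {n : ℕ} {c : Fin n → Fin n → ℝ} (hc : ∀ j m, 0 < c j m)
    (σ : Equiv.Perm (Fin n)) : 0 < pPerm c σ :=
  Finset.prod_pos fun m _ => hc (σ m) m

/-- Exchanging the values of `σ` at `a` and `b` only changes two factors of `pPerm c σ`. -/
theorem pPerm_mul_swap {n : ℕ} (c : Fin n → Fin n → ℝ) (σ : Equiv.Perm (Fin n)) (a b : Fin n) :
    pPerm c (σ * Equiv.swap a b) * (c (σ a) a * c (σ b) b) =
      pPerm c σ * (c (σ b) a * c (σ a) b) := by
  obtain rfl | hab := eq_or_ne a b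
  · rw [Equiv.swap_self, ← Equiv.Perm.one_def, mul_one]
  have hb : b ∈ Finset.univ.erase a := by simp [hab.symm]
  have hrest : ∏ m ∈ (Finset.univ.erase a).erase b, c ((σ * Equiv.swap a b) m) m =
      ∏ m ∈ (Finset.univ.erase a).erase b, c (σ m) m := by
    refine Finset.prod_congr rfl fun m hm => ?_
    simp only [Finset.mem_erase, Finset.mem_univ, and_true] at hm
    rw [Equiv.Perm.mul_apply, Equiv.swap_apply_of_ne_of_ne hm.2 hm.1]
  unfold pPerm
  rw [← Finset.mul_prod_erase _ _ (Finset.mem_univ a), ← Finset.mul_prod_erase _ _ hb, hrest,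
    ← Finset.mul_prod_erase _ (fun m => c (σ m) m) (Finset.mem_univ a),
    ← Finset.mul_prod_erase _ (fun m => c (σ m) m) hb]
  simp only [Equiv.Perm.mul_apply, Equiv.swap_apply_left, Equiv.swap_apply_right]
  ring

theorem sum_pPerm_filter_swap {n : ℕ} (c : Fin n → Fin n → ℝ) (a j k : Fin n) :
    ∑ σ ∈ Finset.univ.filter (fun σ : Equiv.Perm (Fin n) => σ a = k), pPerm c σ =
      ∑ σ ∈ Finset.univ.filter (fun σ : Equiv.Perm (Fin n) => σ a = j),
        pPerm c (Equiv.swap j k * σ) := by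
  refine (Finset.sum_equiv (Equiv.mulLeft (Equiv.swap j k)) (fun σ => ?_) fun σ _ => rfl).symm
  simp [Equiv.swap_apply_eq_iff]

/-- Equation (6) of the paper: the matching-quality measure
`Γ_m = max_{j,k} p_{mj}/p_{mk}`, where `p_{mj} = ∑_{σ(0)=j} p_σ`, is bounded by
`max_{j,k,l} [c(j,0)/c(j,l)] / [c(k,0)/c(k,l)]`. -/
theorem stmt_9 (n : ℕ) [NeZero n] (hn : 2 ≤ n)
    (c : Fin n → Fin n → ℝ) (hc : ∀ j m, 0 < c j m)
    (pm : Fin n → ℝ)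
    (hpm : ∀ j, pm j = ∑ σ ∈ Finset.univ.filter
      (fun σ : Equiv.Perm (Fin n) => σ 0 = j), pPerm c σ)
    (Γm : ℝ) (hΓm : IsGreatest {x : ℝ | ∃ j k, x = pm j / pm k} Γm)
    (C : ℝ) (hC : IsGreatest
      {x : ℝ | ∃ j k l, x = (c j 0 / c j l) / (c k 0 / c k l)} C) :
    Γm ≤ C := by
  obtain ⟨j, k, rfl⟩ := hΓm.1
  have hpos : 0 < pm k := by
    rw [hpm]
    exact Finset.sum_pos (fun σ _ => pPerm_pos hc σ) ⟨Equiv.swap 0 k, by simp⟩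
  rw [div_le_iff₀ hpos, hpm j, hpm k, sum_pPerm_filter_swap c 0 j k, Finset.mul_sum]
  refine Finset.sum_le_sum fun σ hσ => ?_
  obtain rfl : σ 0 = j := by simpa using hσ
  obtain ⟨l, rfl⟩ := σ.surjective k
  have hCl : (c (σ 0) 0 / c (σ 0) l) / (c (σ l) 0 / c (σ l) l) ≤ C := hC.2 ⟨_, _, l, rfl⟩
  have hswap := pPerm_mul_swap c σ 0 l
  rw [← Equiv.mul_swap_eq_swap_mul]
  have h₁ := hc (σ l) 0
  have h₂ := hc (σ 0) l
  have h₃ := hc (σ l) l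
  calc pPerm c σ
      = (c (σ 0) 0 / c (σ 0) l) / (c (σ l) 0 / c (σ l) l) * pPerm c (σ * Equiv.swap 0 l) := by
        field_simp
        linarith
    _ ≤ C * pPerm c (σ * Equiv.swap 0 l) :=
        mul_le_mul_of_nonneg_right hCl (pPerm_pos hc _).le
end
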